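/- arXiv:2109.07524 — 2 statements merged into one kernel-verified Lean document; each statement's English description precedes it below -/
import Mathlib

section
/- Let S and T be nonempty finite sets of points in the Euclidean plane, and let G be the bipartite graph constructed from S and T as described in the context. Then the minimum cost of a many-to-many matching between S and T equals the minimum cost of a perfect matching in G. -/
open Classical

noncomputable section

/-- A point in the Euclidean plane. -/
abbrev Pt : Type := EuclideanSpace ℝ (Fin 2)

/-- `M` is a many-to-many matching between the planar point sets `S` and `T`:
a set of pairs `(p, q)` with `p ∈ S`, `q ∈ T` such that every point of `S` occurs
as a first coordinate and every point of `T` occurs as a second coordinate. -/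
def IsMMM (S T : Finset Pt) (M : Finset (Pt × Pt)) : Prop :=
  (∀ e ∈ M, e.1 ∈ S ∧ e.2 ∈ T) ∧
  (∀ p ∈ S, ∃ q, (p, q) ∈ M) ∧
  (∀ q ∈ T, ∃ p, (p, q) ∈ M)

/-- The cost of a set of pairs: the sum of the Euclidean distances of the pairs. -/
def mmCost (M : Finset (Pt × Pt)) : ℝ := ∑ e ∈ M, dist e.1 e.2

/-- The distance from `x` to a nearest point of `A`. -/
def minDistTo (A : Finset Pt) (x : Pt) : ℝ := sInf ((fun a => dist x a) '' (A : Set Pt))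

/-- The edges of the constructed bipartite graph `G`.  The `R`-side is `Pt ⊕ Pt`
(`Sum.inl u` for `u ∈ R₀ = S`, `Sum.inr v` for the copy `v̂ ∈ R₁` of `v ∈ T`), and the
`B`-side is `Pt ⊕ Pt` (`Sum.inl v` for `v ∈ B₀ = T`, `Sum.inr u` for the copy `û ∈ B₁`
of `u ∈ S`). -/
def IsGEdge (S T : Finset Pt) : (Pt ⊕ Pt) × (Pt ⊕ Pt) → Prop
  | (Sum.inl u, Sum.inl v) => u ∈ S ∧ v ∈ T          -- E₀ = R₀ × B₀
  | (Sum.inr v, Sum.inr u) => v ∈ T ∧ u ∈ S          -- E₁ = R₁ × B₁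
  | (Sum.inl u, Sum.inr u') => u ∈ S ∧ u' = u        -- E₂ = {(u, û) : u ∈ S}
  | (Sum.inr v, Sum.inl v') => v ∈ T ∧ v' = v        -- E₃ = {(v̂, v) : v ∈ T}

/-- The weights of the edges of the constructed bipartite graph `G`. -/
def edgeWeight (S T : Finset Pt) : (Pt ⊕ Pt) × (Pt ⊕ Pt) → ℝ
  | (Sum.inl u, Sum.inl v) => dist u v               -- E₀ edges: Euclidean distance
  | (Sum.inr _, Sum.inr _) => 0                      -- E₁ edges: weight 0
  | (Sum.inl u, Sum.inr _) => minDistTo T u          -- E₂ edges: distance to nearest point of T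
  | (Sum.inr v, Sum.inl _) => minDistTo S v          -- E₃ edges: distance to nearest point of S

/-- `M` is a perfect matching in the constructed bipartite graph `G`: a set of edges of `G`
such that every vertex of `R ∪ B` lies in exactly one of them. -/
def IsPM (S T : Finset Pt) (M : Finset ((Pt ⊕ Pt) × (Pt ⊕ Pt))) : Prop :=
  (∀ e ∈ M, IsGEdge S T e) ∧
  (∀ u ∈ S, ∃! e, e ∈ M ∧ e.1 = Sum.inl u) ∧         -- each vertex of R₀
  (∀ v ∈ T, ∃! e, e ∈ M ∧ e.1 = Sum.inr v) ∧         -- each vertex of R₁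
  (∀ v ∈ T, ∃! e, e ∈ M ∧ e.2 = Sum.inl v) ∧         -- each vertex of B₀
  (∀ u ∈ S, ∃! e, e ∈ M ∧ e.2 = Sum.inr u)           -- each vertex of B₁

/-- The cost of a perfect matching in `G`: the sum of the weights of its edges. -/
def pmCost (S T : Finset Pt) (M : Finset ((Pt ⊕ Pt) × (Pt ⊕ Pt))) : ℝ :=
  ∑ e ∈ M, edgeWeight S T e

theorem minDistTo_le {A : Finset Pt} {a : Pt} (ha : a ∈ A) (x : Pt) :
    minDistTo A x ≤ dist x a :=
  csInf_le ⟨0, by rintro _ ⟨b, -, rfl⟩; exact dist_nonneg⟩ ⟨a, ha, rfl⟩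

theorem minDistTo_nonneg (A : Finset Pt) (x : Pt) : 0 ≤ minDistTo A x :=
  Real.sInf_nonneg (by rintro _ ⟨b, -, rfl⟩; exact dist_nonneg)

theorem exists_dist_eq_minDistTo {A : Finset Pt} (hA : A.Nonempty) (x : Pt) :
    ∃ a ∈ A, dist x a = minDistTo A x := by
  obtain ⟨a, ha, h⟩ : minDistTo A x ∈ (fun a => dist x a) '' (A : Set Pt) :=
    Set.Nonempty.csInf_mem (hA.to_set.image _) (A.finite_toSet.image _)
  exact ⟨a, ha, h⟩

theorem edgeWeight_nonneg (S T : Finset Pt) (e : (Pt ⊕ Pt) × (Pt ⊕ Pt)) :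
    0 ≤ edgeWeight S T e := by
  rcases e with ⟨u | u, v | v⟩
  · exact dist_nonneg
  · exact minDistTo_nonneg T u
  · exact minDistTo_nonneg S u
  · exact le_rfl

/-- Replace an edge of the bipartite graph by a pair of points, where `f` and `g` choose partners
for the points matched to their own copies. -/
def toPair (f g : Pt → Pt) : (Pt ⊕ Pt) × (Pt ⊕ Pt) → Pt × Pt
  | (Sum.inl u, Sum.inl v) => (u, v)
  | (Sum.inl u, Sum.inr _) => (u, f u)
  | (Sum.inr v, _) => (g v, v)

/-- A perfect matching yields a many-to-many matching that is at most as expensive. -/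
theorem IsPM.exists_isMMM_mmCost_le {S T : Finset Pt} (hS : S.Nonempty) (hT : T.Nonempty)
    {M : Finset ((Pt ⊕ Pt) × (Pt ⊕ Pt))} (hM : IsPM S T M) :
    ∃ M', IsMMM S T M' ∧ mmCost M' ≤ pmCost S T M := by
  choose f hfT hf using exists_dist_eq_minDistTo hT
  choose g hgS hg using exists_dist_eq_minDistTo hS
  obtain ⟨hE, hR₀, -, hB₀, -⟩ := hM
  set K := M.filter fun e => ¬ (e.1.isRight ∧ e.2.isRight) with hK
  refine ⟨K.image (toPair f g), ⟨?_, ?_, ?_⟩, ?_⟩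
  · intro e he
    obtain ⟨⟨u | u, v | v⟩, hd, rfl⟩ := Finset.mem_image.1 he
    · exact hE _ (Finset.mem_filter.1 hd).1
    · exact ⟨(hE _ (Finset.mem_filter.1 hd).1).1, hfT u⟩
    · exact ⟨hgS u, (hE _ (Finset.mem_filter.1 hd).1).1⟩
    · simp [hK] at hd
  · intro p hp
    obtain ⟨⟨_, v | v⟩, ⟨he, rfl⟩, -⟩ := hR₀ p hp
    · exact ⟨v, Finset.mem_image.2 ⟨_, Finset.mem_filter.2 ⟨he, by simp⟩, rfl⟩⟩
    · exact ⟨f p, Finset.mem_image.2 ⟨_, Finset.mem_filter.2 ⟨he, by simp⟩, rfl⟩⟩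
  · intro q hq
    obtain ⟨⟨u | u, _⟩, ⟨he, rfl⟩, -⟩ := hB₀ q hq
    · exact ⟨u, Finset.mem_image.2 ⟨_, Finset.mem_filter.2 ⟨he, by simp⟩, rfl⟩⟩
    · obtain rfl : q = u := (hE _ he).2
      exact ⟨g q, Finset.mem_image.2 ⟨_, Finset.mem_filter.2 ⟨he, by simp⟩, rfl⟩⟩
  · calc mmCost (K.image (toPair f g))
        ≤ ∑ e ∈ K, dist (toPair f g e).1 (toPair f g e).2 :=
          Finset.sum_image_le_of_nonneg fun _ _ => dist_nonneg
      _ = ∑ e ∈ K, edgeWeight S T e := by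
          refine Finset.sum_congr rfl ?_
          rintro ⟨u | u, v | v⟩ he
          · rfl
          · exact hf u
          · exact (dist_comm _ _).trans (hg u)
          · simp [hK] at he
      _ ≤ pmCost S T M :=
          Finset.sum_le_sum_of_subset_of_nonneg (Finset.filter_subset _ _)
            fun e _ _ => edgeWeight_nonneg S T e

/-- Every finite set of pairs contains a maximal set of pairs with pairwise distinct first and
pairwise distinct second coordinates. -/
theorem exists_maximal_injOn_fst_snd {α β : Type*} [DecidableEq α] [DecidableEq β]
    (M : Finset (α × β)) :
    ∃ N ⊆ M, Set.InjOn Prod.fst (N : Set (α × β)) ∧ Set.InjOn Prod.snd (N : Set (α × β)) ∧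
      ∀ e ∈ M, e.1 ∈ N.image Prod.fst ∨ e.2 ∈ N.image Prod.snd := by
  obtain ⟨N, hN, hmax⟩ := Finset.exists_max_image
    (M.powerset.filter fun N : Finset (α × β) => Set.InjOn Prod.fst (N : Set (α × β)) ∧
      Set.InjOn Prod.snd (N : Set (α × β))) Finset.card ⟨∅, by simp⟩
  simp only [Finset.mem_filter, Finset.mem_powerset] at hN hmax
  refine ⟨N, hN.1, hN.2.1, hN.2.2, fun e he => ?_⟩
  by_contra! h
  have heN : e ∉ N := fun h' => h.1 (Finset.mem_image_of_mem _ h')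
  have := hmax (insert e N) ⟨Finset.insert_subset he hN.1, by
    rw [Finset.coe_insert, Set.injOn_insert (by simpa using heN),
      Set.injOn_insert (by simpa using heN)]
    exact ⟨⟨hN.2.1, by simpa using h.1⟩, hN.2.2, by simpa using h.2⟩⟩
  rw [Finset.card_insert_of_notMem heN] at this
  omega

/-- The edges of the bipartite graph determined by a set `N` of disjoint pairs: the pairs of `N`,
their copies, and the edges joining the points not covered by `N` to their copies. -/
def matchingOfPairs (S T : Finset Pt) (N : Finset (Pt × Pt)) :
    Finset ((Pt ⊕ Pt) × (Pt ⊕ Pt)) :=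
  (N.image (fun e => (Sum.inl e.1, Sum.inl e.2)) ∪
    N.image (fun e => (Sum.inr e.2, Sum.inr e.1))) ∪
  ((S \ N.image Prod.fst).image (fun u => (Sum.inl u, Sum.inr u)) ∪
    (T \ N.image Prod.snd).image (fun v => (Sum.inr v, Sum.inl v)))

theorem isPM_matchingOfPairs {S T : Finset Pt} {N : Finset (Pt × Pt)}
    (hN : ∀ e ∈ N, e.1 ∈ S ∧ e.2 ∈ T) (h₁ : Set.InjOn Prod.fst (N : Set (Pt × Pt)))
    (h₂ : Set.InjOn Prod.snd (N : Set (Pt × Pt))) : IsPM S T (matchingOfPairs S T N) := by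
  have mem_ll (u v : Pt) :
      ((Sum.inl u, Sum.inl v) : (Pt ⊕ Pt) × (Pt ⊕ Pt)) ∈ matchingOfPairs S T N ↔ (u, v) ∈ N := by
    simp [matchingOfPairs]
  have mem_rr (u v : Pt) :
      ((Sum.inr v, Sum.inr u) : (Pt ⊕ Pt) × (Pt ⊕ Pt)) ∈ matchingOfPairs S T N ↔ (u, v) ∈ N := by
    simp [matchingOfPairs]
  have mem_lr (u u' : Pt) :
      ((Sum.inl u, Sum.inr u') : (Pt ⊕ Pt) × (Pt ⊕ Pt)) ∈ matchingOfPairs S T N ↔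
        u ∈ S ∧ u' = u ∧ ∀ v, (u, v) ∉ N := by
    simp [matchingOfPairs]; grind
  have mem_rl (v v' : Pt) :
      ((Sum.inr v, Sum.inl v') : (Pt ⊕ Pt) × (Pt ⊕ Pt)) ∈ matchingOfPairs S T N ↔
        v ∈ T ∧ v' = v ∧ ∀ u, (u, v) ∉ N := by
    simp [matchingOfPairs]; grind
  have inj₁ {u v v'} (h : (u, v) ∈ N) (h' : (u, v') ∈ N) : v = v' :=
    congrArg Prod.snd (h₁ h h' rfl)
  have inj₂ {u u' v} (h : (u, v) ∈ N) (h' : (u', v) ∈ N) : u = u' :=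
    congrArg Prod.fst (h₂ h h' rfl)
  refine ⟨?_, ?_, ?_, ?_, ?_⟩
  · rintro ⟨u | u, v | v⟩ he
    · exact hN _ ((mem_ll _ _).1 he)
    · exact ⟨((mem_lr _ _).1 he).1, ((mem_lr _ _).1 he).2.1⟩
    · exact ⟨((mem_rl _ _).1 he).1, ((mem_rl _ _).1 he).2.1⟩
    · exact (hN _ ((mem_rr _ _).1 he)).symm
  · intro u hu
    by_cases h : ∃ v, (u, v) ∈ N
    · obtain ⟨v, hv⟩ := h
      refine ⟨(Sum.inl u, Sum.inl v), ⟨(mem_ll _ _).2 hv, rfl⟩, ?_⟩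
      rintro ⟨_, w | w⟩ ⟨he, rfl⟩
      · rw [inj₁ hv ((mem_ll _ _).1 he)]
      · exact absurd hv (((mem_lr _ _).1 he).2.2 v)
    · refine ⟨(Sum.inl u, Sum.inr u), ⟨(mem_lr _ _).2 ⟨hu, rfl, not_exists.1 h⟩, rfl⟩, ?_⟩
      rintro ⟨_, w | w⟩ ⟨he, rfl⟩
      · exact absurd ⟨w, (mem_ll _ _).1 he⟩ h
      · rw [((mem_lr _ _).1 he).2.1]
  · intro v hv
    by_cases h : ∃ u, (u, v) ∈ N
    · obtain ⟨u, hu⟩ := h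
      refine ⟨(Sum.inr v, Sum.inr u), ⟨(mem_rr _ _).2 hu, rfl⟩, ?_⟩
      rintro ⟨_, w | w⟩ ⟨he, rfl⟩
      · exact absurd hu (((mem_rl _ _).1 he).2.2 u)
      · rw [inj₂ hu ((mem_rr _ _).1 he)]
    · refine ⟨(Sum.inr v, Sum.inl v), ⟨(mem_rl _ _).2 ⟨hv, rfl, not_exists.1 h⟩, rfl⟩, ?_⟩
      rintro ⟨_, w | w⟩ ⟨he, rfl⟩
      · rw [((mem_rl _ _).1 he).2.1]
      · exact absurd ⟨w, (mem_rr _ _).1 he⟩ h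
  · intro v hv
    by_cases h : ∃ u, (u, v) ∈ N
    · obtain ⟨u, hu⟩ := h
      refine ⟨(Sum.inl u, Sum.inl v), ⟨(mem_ll _ _).2 hu, rfl⟩, ?_⟩
      rintro ⟨w | w, _⟩ ⟨he, rfl⟩
      · rw [inj₂ hu ((mem_ll _ _).1 he)]
      · obtain ⟨-, rfl, hw⟩ := (mem_rl _ _).1 he
        exact absurd hu (hw u)
    · refine ⟨(Sum.inr v, Sum.inl v), ⟨(mem_rl _ _).2 ⟨hv, rfl, not_exists.1 h⟩, rfl⟩, ?_⟩
      rintro ⟨w | w, _⟩ ⟨he, rfl⟩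
      · exact absurd ⟨w, (mem_ll _ _).1 he⟩ h
      · rw [((mem_rl _ _).1 he).2.1]
  · intro u hu
    by_cases h : ∃ v, (u, v) ∈ N
    · obtain ⟨v, hv⟩ := h
      refine ⟨(Sum.inr v, Sum.inr u), ⟨(mem_rr _ _).2 hv, rfl⟩, ?_⟩
      rintro ⟨w | w, _⟩ ⟨he, rfl⟩
      · obtain ⟨-, rfl, hw⟩ := (mem_lr _ _).1 he
        exact absurd hv (hw v)
      · rw [inj₁ hv ((mem_rr _ _).1 he)]
    · refine ⟨(Sum.inl u, Sum.inr u), ⟨(mem_lr _ _).2 ⟨hu, rfl, not_exists.1 h⟩, rfl⟩, ?_⟩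
      rintro ⟨w | w, _⟩ ⟨he, rfl⟩
      · rw [((mem_lr _ _).1 he).2.1]
      · exact absurd ⟨w, (mem_rr _ _).1 he⟩ h

theorem pmCost_matchingOfPairs (S T : Finset Pt) (N : Finset (Pt × Pt)) :
    pmCost S T (matchingOfPairs S T N) = mmCost N +
      (∑ u ∈ S \ N.image Prod.fst, minDistTo T u + ∑ v ∈ T \ N.image Prod.snd, minDistTo S v) := by
  rw [pmCost, matchingOfPairs, Finset.sum_union, Finset.sum_union, Finset.sum_union,
    Finset.sum_image, Finset.sum_image, Finset.sum_image, Finset.sum_image]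
  · simp [edgeWeight, mmCost]
  all_goals first
    | (rw [Finset.disjoint_left]; grind)
    | (intro a _ b _ h; grind)

/-- A many-to-many matching yields a perfect matching that is at most as expensive. -/
theorem IsMMM.exists_isPM_pmCost_le {S T : Finset Pt} {M' : Finset (Pt × Pt)}
    (hM' : IsMMM S T M') : ∃ M, IsPM S T M ∧ pmCost S T M ≤ mmCost M' := by
  obtain ⟨hE, hSM, hTM⟩ := hM'
  obtain ⟨N, hNM, h₁, h₂, hmax⟩ := exists_maximal_injOn_fst_snd M'
  choose! f hf using hSM
  choose! g hg using hTM
  refine ⟨matchingOfPairs S T N, isPM_matchingOfPairs (fun e he => hE e (hNM he)) h₁ h₂, ?_⟩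
  set A := S \ N.image Prod.fst
  set B := T \ N.image Prod.snd
  have hAM : ∀ u ∈ A, (u, f u) ∈ M' := fun u hu => hf u (Finset.mem_sdiff.1 hu).1
  have hBM : ∀ v ∈ B, (g v, v) ∈ M' := fun v hv => hg v (Finset.mem_sdiff.1 hv).1
  calc pmCost S T (matchingOfPairs S T N)
      = mmCost N + (∑ u ∈ A, minDistTo T u + ∑ v ∈ B, minDistTo S v) :=
        pmCost_matchingOfPairs S T N
    _ ≤ mmCost N + (∑ u ∈ A, dist u (f u) + ∑ v ∈ B, dist (g v) v) := by
        gcongr with u hu v hv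
        · exact minDistTo_le (hE _ (hAM u hu)).2 u
        · rw [dist_comm]
          exact minDistTo_le (hE _ (hBM v hv)).1 v
    _ = mmCost (N ∪ (A.image (fun u => (u, f u)) ∪ B.image (fun v => (g v, v)))) := by
        rw [mmCost, mmCost, Finset.sum_union, Finset.sum_union, Finset.sum_image, Finset.sum_image]
        · intro a _ b _ h; grind
        · intro a _ b _ h; grind
        · refine Finset.disjoint_left.2 fun e heA heB => ?_
          obtain ⟨u, hu, rfl⟩ := Finset.mem_image.1 heA
          obtain ⟨v, hv, he⟩ := Finset.mem_image.1 heB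
          rcases hmax _ (hAM u hu) with h | h
          · exact (Finset.mem_sdiff.1 hu).2 h
          · rw [← he] at h
            exact (Finset.mem_sdiff.1 hv).2 h
        · refine Finset.disjoint_left.2 fun e heN he => ?_
          rcases Finset.mem_union.1 he with he | he
          · obtain ⟨u, hu, rfl⟩ := Finset.mem_image.1 he
            exact (Finset.mem_sdiff.1 hu).2 (Finset.mem_image_of_mem Prod.fst heN)
          · obtain ⟨v, hv, rfl⟩ := Finset.mem_image.1 he
            exact (Finset.mem_sdiff.1 hv).2 (Finset.mem_image_of_mem Prod.snd heN)
    _ ≤ mmCost M' := by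
        refine Finset.sum_le_sum_of_subset_of_nonneg ?_ fun _ _ _ => dist_nonneg
        refine Finset.union_subset hNM (Finset.union_subset ?_ ?_)
        · exact Finset.image_subset_iff.2 hAM
        · exact Finset.image_subset_iff.2 hBM

theorem isMMM_product {S T : Finset Pt} (hS : S.Nonempty) (hT : T.Nonempty) :
    IsMMM S T (S ×ˢ T) := by
  obtain ⟨s, hs⟩ := hS
  obtain ⟨t, ht⟩ := hT
  exact ⟨fun e he => Finset.mem_product.1 he, fun p hp => ⟨t, Finset.mk_mem_product hp ht⟩,
    fun q hq => ⟨s, Finset.mk_mem_product hs hq⟩⟩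

theorem min_many_to_many_cost_eq_min_perfect_matching_cost
    (S T : Finset Pt) (hS : S.Nonempty) (hT : T.Nonempty) :
    sInf {x : ℝ | ∃ M' : Finset (Pt × Pt), IsMMM S T M' ∧ mmCost M' = x} =
      sInf {x : ℝ | ∃ M : Finset ((Pt ⊕ Pt) × (Pt ⊕ Pt)), IsPM S T M ∧ pmCost S T M = x} := by
  have hMMM := isMMM_product hS hT
  obtain ⟨M₀, hM₀, -⟩ := hMMM.exists_isPM_pmCost_le
  have hbdd : BddBelow {x : ℝ | ∃ M', IsMMM S T M' ∧ mmCost M' = x} :=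
    ⟨0, by rintro _ ⟨M', -, rfl⟩; exact Finset.sum_nonneg fun _ _ => dist_nonneg⟩
  have hbdd' : BddBelow {x : ℝ | ∃ M, IsPM S T M ∧ pmCost S T M = x} :=
    ⟨0, by rintro _ ⟨M, -, rfl⟩; exact Finset.sum_nonneg fun e _ => edgeWeight_nonneg S T e⟩
  apply le_antisymm
  · refine le_csInf ⟨_, M₀, hM₀, rfl⟩ ?_
    rintro _ ⟨M, hM, rfl⟩
    obtain ⟨M', hM', hle⟩ := hM.exists_isMMM_mmCost_le hS hT
    exact (csInf_le hbdd ⟨M', hM', rfl⟩).trans hle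
  · refine le_csInf ⟨_, S ×ˢ T, hMMM, rfl⟩ ?_
    rintro _ ⟨M', hM', rfl⟩
    obtain ⟨M, hM, hle⟩ := hM'.exists_isPM_pmCost_le
    exact (csInf_le hbdd' ⟨M, hM, rfl⟩).trans hle
end
end

section
/- Let (R, B, E) be a finite bipartite graph with |R| = n, with integer edge costs c such that every c(e) is an integer multiple of n + 1. Let y : R ∪ B → ℝ satisfy y(u) + y(v) ≤ c(u,v) + 1 for every edge (u,v) ∈ E, and let M ⊆ E be a perfect matching with y(u) + y(v) = c(u,v) for every (u,v) ∈ M (i.e., M is 1-optimal with dual y). Then M is a minimum-cost perfect matching: c(M) ≤ c(M') for every perfect matching M' ⊆ E. -/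
open Classical

noncomputable section

/-- `M` is a matching in the bipartite graph with parts `α`, `β` and edge set `E`:
a set of edges in which no vertex occurs in two edges. -/
def IsBMatching {α β : Type*} (E M : Finset (α × β)) : Prop :=
  M ⊆ E ∧ ∀ e ∈ M, ∀ e' ∈ M, (e.1 = e'.1 ∨ e.2 = e'.2) → e = e'

/-- `M` is a perfect matching in the bipartite graph with parts `α`, `β` and edge set `E`:
a matching in which every vertex occurs in (exactly) one edge. -/
def IsBPerfectMatching {α β : Type*} [Fintype α] [Fintype β] (E M : Finset (α × β)) : Prop :=
  IsBMatching E M ∧ (∀ a : α, ∃ e ∈ M, e.1 = a) ∧ (∀ b : β, ∃ e ∈ M, e.2 = b)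

/-- A perfect matching meets every left vertex exactly once. -/
theorem IsBPerfectMatching.sum_fst {α β N : Type*} [Fintype α] [Fintype β] [AddCommMonoid N]
    {E M : Finset (α × β)} (hM : IsBPerfectMatching E M) (f : α → N) :
    ∑ e ∈ M, f e.1 = ∑ a, f a :=
  Finset.sum_nbij Prod.fst (fun _ _ => Finset.mem_univ _)
    (fun e he e' he' h => hM.1.2 e he e' he' (Or.inl h))
    (fun a _ => hM.2.1 a) (fun _ _ => rfl)

/-- A perfect matching meets every right vertex exactly once. -/
theorem IsBPerfectMatching.sum_snd {α β N : Type*} [Fintype α] [Fintype β] [AddCommMonoid N]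
    {E M : Finset (α × β)} (hM : IsBPerfectMatching E M) (f : β → N) :
    ∑ e ∈ M, f e.2 = ∑ b, f b :=
  Finset.sum_nbij Prod.snd (fun _ _ => Finset.mem_univ _)
    (fun e he e' he' h => hM.1.2 e he e' he' (Or.inr h))
    (fun b _ => hM.2.2 b) (fun _ _ => rfl)

/-- Any vertex potential has the same total over every perfect matching. -/
theorem IsBPerfectMatching.sum_potential {α β : Type*} [Fintype α] [Fintype β]
    {E M : Finset (α × β)} (hM : IsBPerfectMatching E M) (y : α ⊕ β → ℝ) :
    ∑ e ∈ M, (y (Sum.inl e.1) + y (Sum.inr e.2)) =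
      ∑ a, y (Sum.inl a) + ∑ b, y (Sum.inr b) := by
  rw [Finset.sum_add_distrib, hM.sum_fst fun a => y (Sum.inl a),
    hM.sum_snd fun b => y (Sum.inr b)]

theorem IsBPerfectMatching.card_eq {α β : Type*} [Fintype α] [Fintype β]
    {E M : Finset (α × β)} (hM : IsBPerfectMatching E M) : M.card = Fintype.card α := by
  simpa using hM.sum_fst fun _ => (1 : ℕ)

/-- If all the (integer) edge costs are multiples of `n + 1`, where `n = |R|`,
then a 1-optimal matching is a minimum-cost perfect matching. -/
theorem one_optimal_matching_is_min_for_scaled_costs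
    {α β : Type*} [Fintype α] [Fintype β]
    (E : Finset (α × β)) (c : α × β → ℤ)
    (hmult : ∀ e ∈ E, ((Fintype.card α : ℤ) + 1) ∣ c e)
    (y : α ⊕ β → ℝ)
    (hfeas : ∀ e ∈ E, y (Sum.inl e.1) + y (Sum.inr e.2) ≤ (c e : ℝ) + 1)
    (M : Finset (α × β)) (hM : IsBPerfectMatching E M)
    (htight : ∀ e ∈ M, y (Sum.inl e.1) + y (Sum.inr e.2) = (c e : ℝ)) :
    ∀ M' : Finset (α × β), IsBPerfectMatching E M' → ∑ e ∈ M, c e ≤ ∑ e ∈ M', c e := by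
  intro M' hM'
  have h : (∑ e ∈ M, c e : ℤ) ≤ ∑ e ∈ M', c e + Fintype.card α := by
    have hreal : (∑ e ∈ M, (c e : ℝ)) ≤ ∑ e ∈ M', (c e : ℝ) + Fintype.card α := by
      calc ∑ e ∈ M, (c e : ℝ)
          = ∑ e ∈ M, (y (Sum.inl e.1) + y (Sum.inr e.2)) :=
            (Finset.sum_congr rfl htight).symm
        _ = ∑ e ∈ M', (y (Sum.inl e.1) + y (Sum.inr e.2)) := by
            rw [hM.sum_potential, hM'.sum_potential]
        _ ≤ ∑ e ∈ M', ((c e : ℝ) + 1) :=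
            Finset.sum_le_sum fun e he => hfeas e (hM'.1.1 he)
        _ = ∑ e ∈ M', (c e : ℝ) + Fintype.card α := by
            rw [Finset.sum_add_distrib]
            simp [hM'.card_eq]
    exact_mod_cast hreal
  have hdvd : ((Fintype.card α : ℤ) + 1) ∣ ∑ e ∈ M, c e - ∑ e ∈ M', c e :=
    dvd_sub (Finset.dvd_sum fun e he => hmult e (hM.1.1 he))
      (Finset.dvd_sum fun e he => hmult e (hM'.1.1 he))
  by_contra! hlt
  have := Int.le_of_dvd (by lia) hdvd
  lia
end
end
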